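/- arXiv:2103.14446 — 9 statements merged into one kernel-verified Lean document; each statement's English description precedes it below -/
import Mathlib

section
/- A Boolean contact algebra satisfies (C5): for all x, if x ≠ 0 and x ≠ 1 then x C xᶜ, if and only if it satisfies (C5*): for all x and y, if x ≠ 0, x ≠ 1 and x ≪ y, then x < y. -/
variable {B : Type*} [BooleanAlgebra B]

/-- A Boolean contact algebra structure on a Boolean algebra `B`. -/
structure BCA (B : Type*) [BooleanAlgebra B] where
  C : B → B → Prop
  c0 : ∀ x : B, ¬ C ⊥ x
  c1 : ∀ x y : B, x ≠ ⊥ → x ≤ y → C x y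
  c2 : ∀ x y : B, C x y → C y x
  c3 : ∀ x y z : B, x ≤ y → C z x → C z y
  c4 : ∀ x y z : B, C x (y ⊔ z) → C x y ∨ C x z

namespace BCA

/-- The well-inside relation: `x ≪ y` iff `¬ (x C yᶜ)`. -/
def wi (A : BCA B) (x y : B) : Prop := ¬ A.C x yᶜ

/-- `Q₁` covers `Q₂` iff every element of `Q₁` contains some element of `Q₂`. -/
def Covers (Q₁ Q₂ : Set B) : Prop := ∀ x ∈ Q₁, ∃ y ∈ Q₂, y ≤ x

/-- A Grzegorczyk representative of a point. -/
def IsGRep (A : BCA B) (Q : Set B) : Prop :=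
  Q.Nonempty ∧ (⊥ : B) ∉ Q ∧
    (∀ u ∈ Q, ∀ v ∈ Q, u = v ∨ A.wi u v ∨ A.wi v u) ∧
    (∀ u ∈ Q, ∃ v ∈ Q, A.wi v u) ∧
    (∀ x y : B, (∀ u ∈ Q, u ⊓ x ≠ ⊥ ∧ u ⊓ y ≠ ⊥) → A.C x y)

/-- An abstractive set. -/
def IsAbstractive (A : BCA B) (S : Set B) : Prop :=
  S.Nonempty ∧ (⊥ : B) ∉ S ∧
    (∀ u ∈ S, ∀ v ∈ S, u = v ∨ A.wi u v ∨ A.wi v u) ∧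
    ¬ ∃ x ∈ S, ∀ y ∈ S, x ≤ y

/-- A Whitehead representative of a point. -/
def IsWRep (A : BCA B) (S : Set B) : Prop :=
  A.IsAbstractive S ∧ ∀ T : Set B, A.IsAbstractive T → Covers S T → Covers T S

/-- An ω-abstractive set: an abstractive set mutually covering with a countable abstractive set. -/
def IsOmegaAbstractive (A : BCA B) (S : Set B) : Prop :=
  A.IsAbstractive S ∧
    ∃ T : Set B, T.Countable ∧ A.IsAbstractive T ∧ Covers S T ∧ Covers T S

/-- A filter of the Boolean algebra `B`. -/
def IsFilter (F : Set B) : Prop :=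
  F.Nonempty ∧ (⊥ : B) ∉ F ∧
    (∀ x ∈ F, ∀ y : B, x ≤ y → y ∈ F) ∧
    (∀ x ∈ F, ∀ y ∈ F, x ⊓ y ∈ F)

/-- A round filter. -/
def IsRoundFilter (A : BCA B) (F : Set B) : Prop :=
  IsFilter F ∧ ∀ x ∈ F, ∃ y ∈ F, A.wi y x

/-- A Grzegorczyk point: the filter generated by a G-representative. -/
def IsGPoint (A : BCA B) (G : Set B) : Prop :=
  ∃ Q : Set B, A.IsGRep Q ∧ G = {y : B | ∃ x ∈ Q, x ≤ y}

/-- Atomlessness of the Boolean algebra. -/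
def Atomless (B : Type*) [BooleanAlgebra B] : Prop :=
  ∀ x : B, x ≠ ⊥ → ∃ y : B, y ≠ ⊥ ∧ y < x

/-- The interpolation axiom (DV6). -/
def DV6 (A : BCA B) : Prop := ∀ x y : B, A.wi x y → ∃ z : B, A.wi x z ∧ A.wi z y

/-- The non-tangential part axiom (DV7). -/
def DV7 (A : BCA B) : Prop := ∀ x : B, x ≠ ⊥ → ∃ y : B, y ≠ ⊥ ∧ A.wi y x

/-- The connectedness axiom (C5). -/
def C5 (A : BCA B) : Prop := ∀ x : B, x ≠ ⊥ → x ≠ ⊤ → A.C x xᶜ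

/-- The countable chain condition for a Boolean algebra. -/
def CCC (B : Type*) [BooleanAlgebra B] : Prop :=
  ∀ S : Set B, (∀ x ∈ S, x ≠ ⊥) → (S.Pairwise fun x y => x ⊓ y = ⊥) → S.Countable

end BCA

/-- The well-inside relation is contained in the order. -/
theorem BCA.wi.le {B : Type*} [BooleanAlgebra B] {A : BCA B} {x y : B} (h : A.wi x y) :
    x ≤ y := by
  rw [← disjoint_compl_right_iff, disjoint_iff]
  by_contra hne
  have hC : A.C (x ⊓ yᶜ) yᶜ := A.c1 _ _ hne inf_le_right
  exact h (A.c2 _ _ (A.c3 _ _ _ inf_le_left (A.c2 _ _ hC)))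

theorem stmt_1 {B : Type*} [BooleanAlgebra B] (A : BCA B) :
    (∀ x : B, x ≠ ⊥ → x ≠ ⊤ → A.C x xᶜ) ↔
      (∀ x y : B, x ≠ ⊥ → x ≠ ⊤ → A.wi x y → x < y) := by
  constructor
  · intro h x y hx hx' hxy
    refine lt_of_le_of_ne hxy.le ?_
    rintro rfl
    exact hxy (h x hx hx')
  · intro h x hx hx'
    by_contra hC
    exact lt_irrefl x (h x x hx hx' hC)
end

section
/- Let B be an atomless Boolean contact algebra satisfying (DV7). Then every x ≠ 0 has two nonzero parts separated from each other: there exist u and z with 0 ≠ u ≤ x, 0 ≠ z ≤ x, and ¬(u C z). -/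
variable {B : Type*} [BooleanAlgebra B]

theorem stmt_2 {B : Type*} [BooleanAlgebra B] (A : BCA B)
    (hat : BCA.Atomless B) (hdv7 : A.DV7) (x : B) (hx : x ≠ ⊥) :
    ∃ u z : B, u ≠ ⊥ ∧ u ≤ x ∧ z ≠ ⊥ ∧ z ≤ x ∧ ¬ A.C u z := by
  obtain ⟨y, hy, hyx⟩ := hat x hx
  obtain ⟨u, hu, huy⟩ := hdv7 y hy
  refine ⟨u, x \ y, hu, huy.le.trans hyx.le, ?_, sdiff_le, fun h => huy ?_⟩
  · rw [Ne, sdiff_eq_bot_iff]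
    exact hyx.not_ge
  · exact A.c3 _ _ _ (sdiff_eq (x := x) (y := y) ▸ inf_le_right) h
end

section
/- Let B be an atomless Boolean contact algebra satisfying (DV7). Then every G-representative Q of B satisfies condition (A): there is no x ∈ Q with x ≤ y for all y ∈ Q. -/
variable {B : Type*} [BooleanAlgebra B]

theorem stmt_3 {B : Type*} [BooleanAlgebra B] (A : BCA B)
    (hat : BCA.Atomless B) (hdv7 : A.DV7) (Q : Set B) (hQ : A.IsGRep Q) :
    ¬ ∃ x ∈ Q, ∀ y ∈ Q, x ≤ y := by
  rintro ⟨x, hxQ, hx⟩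
  obtain ⟨-, hbot, -, -, hcontact⟩ := hQ
  obtain ⟨y, hy, hyx⟩ := hat x (ne_of_mem_of_not_mem hxQ hbot)
  obtain ⟨z, hz, hzy⟩ := hdv7 y hy
  have hdiff : x \ y ≠ ⊥ := fun h => hyx.not_ge (sdiff_eq_bot_iff.mp h)
  have hC : A.C z (x \ y) := hcontact _ _ fun u hu => by
    rw [inf_eq_right.mpr (hzy.le.trans (hyx.le.trans (hx u hu))),
      inf_eq_right.mpr (sdiff_le.trans (hx u hu))]
    exact ⟨hz, hdiff⟩
  exact hzy (A.c3 _ _ _ (sdiff_eq.trans_le inf_le_right) hC)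
end

section
/- In a Boolean contact algebra, the covering relation is symmetric on G-representatives: if Q₁ and Q₂ are G-representatives and Q₁ covers Q₂, then Q₂ covers Q₁. -/
variable {B : Type*} [BooleanAlgebra B]

namespace BCA

theorem wi.le_s4 {B : Type*} [BooleanAlgebra B] {A : BCA B} {x y : B} (h : A.wi x y) : x ≤ y := by
  by_contra hxy
  have hne : x ⊓ yᶜ ≠ ⊥ := fun h0 => hxy (disjoint_compl_right_iff.mp (disjoint_iff.mpr h0))
  exact h (A.c2 _ _ (A.c3 _ _ _ inf_le_left (A.c2 _ _ (A.c1 _ _ hne inf_le_right))))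

theorem IsGRep.le_total {B : Type*} [BooleanAlgebra B] {A : BCA B} {Q : Set B} (hQ : A.IsGRep Q)
    {u v : B} (hu : u ∈ Q) (hv : v ∈ Q) : u ≤ v ∨ v ≤ u := by
  rcases hQ.2.2.1 u hu v hv with rfl | h | h
  · exact Or.inl le_rfl
  · exact Or.inl h.le_s4
  · exact Or.inr h.le_s4

theorem IsGRep.ne_bot {B : Type*} [BooleanAlgebra B] {A : BCA B} {Q : Set B} (hQ : A.IsGRep Q)
    {u : B} (hu : u ∈ Q) : u ≠ ⊥ :=
  ne_of_mem_of_not_mem hu hQ.2.1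

theorem IsGRep.inf_ne_bot {B : Type*} [BooleanAlgebra B] {A : BCA B} {Q : Set B}
    (hQ : A.IsGRep Q) {u v : B} (hu : u ∈ Q) (hv : v ∈ Q) : u ⊓ v ≠ ⊥ := by
  rcases hQ.le_total hu hv with h | h
  · rw [inf_eq_left.mpr h]
    exact hQ.ne_bot hu
  · rw [inf_eq_right.mpr h]
    exact hQ.ne_bot hv

end BCA

theorem stmt_4 {B : Type*} [BooleanAlgebra B] (A : BCA B) (Q₁ Q₂ : Set B)
    (h₁ : A.IsGRep Q₁) (h₂ : A.IsGRep Q₂) (h : BCA.Covers Q₁ Q₂) :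
    BCA.Covers Q₂ Q₁ := by
  intro v hv
  obtain ⟨w, hw, hwv⟩ := h₂.2.2.2.1 v hv
  by_contra! hno
  refine hwv (h₁.2.2.2.2 w vᶜ fun u hu => ⟨fun h0 => ?_, fun h0 => ?_⟩)
  · obtain ⟨y, hy, hyu⟩ := h u hu
    exact h₂.inf_ne_bot hy hw (le_bot_iff.mp (h0 ▸ inf_le_inf_right w hyu))
  · exact hno u hu (disjoint_compl_right_iff.mp (disjoint_iff.mpr h0))
end

section
/- In a Boolean contact algebra, if Q₁ and Q₂ are G-representatives and Q₁ does not cover Q₂, then there exist x ∈ Q₁ and y ∈ Q₂ that are separated from each other, i.e. ¬(x C y). -/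
variable {B : Type*} [BooleanAlgebra B]

theorem stmt_5 {B : Type*} [BooleanAlgebra B] (A : BCA B) (Q₁ Q₂ : Set B)
    (h₁ : A.IsGRep Q₁) (h₂ : A.IsGRep Q₂) (h : ¬ BCA.Covers Q₁ Q₂) :
    ∃ x ∈ Q₁, ∃ y ∈ Q₂, ¬ A.C x y := by
  obtain ⟨-, -, -, round₁, -⟩ := h₁
  obtain ⟨-, -, -, round₂, contact₂⟩ := h₂
  simp only [BCA.Covers, not_forall, not_exists, not_and] at h
  obtain ⟨x, hx, hxQ₂⟩ := h
  obtain ⟨x', hx', hx'x⟩ := round₁ x hx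
  obtain ⟨y, hy, hyx'⟩ : ∃ y ∈ Q₂, y ⊓ x' = ⊥ := by
    by_contra! hmeet
    exact hx'x (contact₂ x' xᶜ fun u hu =>
      ⟨hmeet u hu, fun hux => hxQ₂ u hu (disjoint_compl_right_iff.1 (disjoint_iff.2 hux))⟩)
  obtain ⟨y', hy', hy'y⟩ := round₂ y hy
  have hx'y : x' ≤ yᶜ := (disjoint_iff.2 hyx').le_compl_left
  exact ⟨x', hx', y', hy', fun hC => hy'y (A.c3 x' yᶜ y' hx'y (A.c2 x' y' hC))⟩
end

section
/- In a Boolean contact algebra, a round filter F satisfies condition (✠): for all x, y ∈ B, if x C z for every z ∈ F and y C z for every z ∈ F, then x C y, if and only if F satisfies condition (†): for all x, y ∈ B, if ¬(x C y) then xᶜ ∈ F or yᶜ ∈ F. -/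
variable {B : Type*} [BooleanAlgebra B]

/-- Elements that are not in contact are disjoint. -/
theorem BCA.le_compl_of_not_C {B : Type*} [BooleanAlgebra B] (A : BCA B) {x z : B}
    (h : ¬ A.C x z) : z ≤ xᶜ := by
  rw [le_compl_iff_disjoint_right, disjoint_iff]
  by_contra hne
  exact h (A.c2 _ _ (A.c3 _ _ _ inf_le_right
    (A.c2 _ _ (A.c1 _ _ hne inf_le_left))))

/-- An element well inside the complement of `x` is not in contact with `x`. -/
theorem BCA.not_C_of_wi_compl {B : Type*} [BooleanAlgebra B] (A : BCA B) {x w : B}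
    (h : A.wi w xᶜ) : ¬ A.C x w := by
  rw [BCA.wi, compl_compl] at h
  exact fun hc => h (A.c2 _ _ hc)

theorem stmt_11 {B : Type*} [BooleanAlgebra B] (A : BCA B) (F : Set B)
    (hF : A.IsRoundFilter F) :
    (∀ x y : B, (∀ z ∈ F, A.C x z) → (∀ z ∈ F, A.C y z) → A.C x y) ↔
      (∀ x y : B, ¬ A.C x y → xᶜ ∈ F ∨ yᶜ ∈ F) := by
  obtain ⟨hfil, hround⟩ := hF
  constructor
  · intro h x y hxy
    by_contra! hn
    exact hxy (h x y
      (fun z hz => by_contra fun hc => hn.1 (hfil.2.2.1 z hz _ (A.le_compl_of_not_C hc)))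
      (fun z hz => by_contra fun hc => hn.2 (hfil.2.2.1 z hz _ (A.le_compl_of_not_C hc))))
  · intro h x y hx hy
    by_contra hxy
    rcases h x y hxy with hc | hc
    · obtain ⟨w, hw, hwx⟩ := hround _ hc
      exact A.not_C_of_wi_compl hwx (hx w hw)
    · obtain ⟨w, hw, hwy⟩ := hround _ hc
      exact A.not_C_of_wi_compl hwy (hy w hw)
end

section
/- Let B be a Boolean contact algebra, and let X be the set of all round filters of B satisfying condition (†): for all x, y ∈ B, if ¬(x C y) then xᶜ ∈ F or yᶜ ∈ F (these are the ends of B). Equip X with the topology generated by the sets E(x) = {F ∈ X : x ∈ F} for x ∈ B. Then X is a Hausdorff topological space. -/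
variable {B : Type*} [BooleanAlgebra B]

/-- The set of ends of a Boolean contact algebra: round filters satisfying (†). -/
def BCA.Ends {B : Type*} [BooleanAlgebra B] (A : BCA B) : Set (Set B) :=
  {F | A.IsRoundFilter F ∧ ∀ x y : B, ¬ A.C x y → xᶜ ∈ F ∨ yᶜ ∈ F}

/-- An end not contained in another is separated from it by some `y` and its complement. -/
theorem BCA.exists_mem_compl_mem_of_mem_ends {B : Type*} [BooleanAlgebra B] (A : BCA B)
    {F G : Set B} (hF : F ∈ A.Ends) (hG : G ∈ A.Ends) (h : ¬ F ⊆ G) : ∃ y ∈ F, yᶜ ∈ G := by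
  obtain ⟨x, hxF, hxG⟩ := Set.not_subset.1 h
  obtain ⟨y, hyF, hyx⟩ := hF.1.2 x hxF
  refine ⟨y, hyF, (hG.2 y xᶜ hyx).resolve_right ?_⟩
  rwa [compl_compl]

/-- A filter does not contain both an element and its complement. -/
theorem BCA.IsFilter.compl_notMem {B : Type*} [BooleanAlgebra B] {F : Set B}
    (hF : BCA.IsFilter F) {y : B} (hy : y ∈ F) : yᶜ ∉ F := fun hy' =>
  hF.2.1 (inf_compl_eq_bot (a := y) ▸ hF.2.2.2 y hy yᶜ hy')

theorem stmt_14 {B : Type*} [BooleanAlgebra B] (A : BCA B) :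
    @T2Space (BCA.Ends A)
      (TopologicalSpace.generateFrom
        {s : Set (BCA.Ends A) | ∃ x : B, s = {F | x ∈ F.1}}) := by
  let := TopologicalSpace.generateFrom
    {s : Set (BCA.Ends A) | ∃ x : B, s = {F | x ∈ F.1}}
  have isOpen (x : B) : IsOpen {F : BCA.Ends A | x ∈ F.1} :=
    TopologicalSpace.isOpen_generateFrom_of_mem ⟨x, rfl⟩
  have disj (y : B) : Disjoint {F : BCA.Ends A | y ∈ F.1} {F : BCA.Ends A | yᶜ ∈ F.1} :=
    Set.disjoint_left.2 fun F hy => F.2.1.1.compl_notMem hy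
  refine ⟨fun F G hne => ?_⟩
  by_cases h : F.1 ⊆ G.1
  · have h' : ¬ G.1 ⊆ F.1 := fun h' => hne (Subtype.ext (h.antisymm h'))
    obtain ⟨y, hyG, hyF⟩ := A.exists_mem_compl_mem_of_mem_ends G.2 F.2 h'
    exact ⟨_, _, isOpen yᶜ, isOpen y, hyF, hyG, (disj y).symm⟩
  · obtain ⟨y, hyF, hyG⟩ := A.exists_mem_compl_mem_of_mem_ends F.2 G.2 h
    exact ⟨_, _, isOpen y, isOpen yᶜ, hyF, hyG, disj y⟩
end

section
/- In RO(ℝ), the set A = {(-1/n, 1/n) : n ∈ ℕ, n ≥ 1} of open intervals is a W-representative: A is an abstractive set, and every abstractive set A' of RO(ℝ) that A covers also covers A. -/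
/-- A set of reals is regular open iff it is the interior of its closure. -/
def RegOpen (U : Set ℝ) : Prop := U = interior (closure U)

/-- An abstractive set of regular open subsets of ℝ. -/
def ROAbstractive (A : Set (Set ℝ)) : Prop :=
  (∀ U ∈ A, RegOpen U) ∧ A.Nonempty ∧ ∅ ∉ A ∧
    (∀ U ∈ A, ∀ V ∈ A, U = V ∨ closure U ⊆ V ∨ closure V ⊆ U) ∧
    ¬ ∃ U ∈ A, ∀ V ∈ A, U ⊆ V

/-- `A₁` covers `A₂` iff every element of `A₁` contains some element of `A₂`. -/
def ROCovers (A₁ A₂ : Set (Set ℝ)) : Prop := ∀ U ∈ A₁, ∃ V ∈ A₂, V ⊆ U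

/-- The family of intervals (-1/n, 1/n), n ≥ 1. -/
def AIntervals : Set (Set ℝ) :=
  {U | ∃ n : ℕ, 1 ≤ n ∧ U = Set.Ioo (-(1/(n : ℝ))) (1/(n : ℝ))}

theorem exists_Ioo_one_div_subset {U : Set ℝ} (hU : U ∈ nhds 0) :
    ∃ n : ℕ, 1 ≤ n ∧ Set.Ioo (-(1 / (n : ℝ))) (1 / (n : ℝ)) ⊆ U := by
  obtain ⟨ε, hε, hεU⟩ := Metric.mem_nhds_iff.1 hU
  obtain ⟨n, hn⟩ := exists_nat_one_div_lt hε
  refine ⟨n + 1, by omega, fun x hx => hεU ?_⟩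
  push_cast at hx
  rw [Metric.mem_ball, Real.dist_eq, sub_zero, abs_lt]
  exact ⟨by linarith [hx.1], by linarith [hx.2]⟩

theorem RegOpen.isOpen {U : Set ℝ} (hU : RegOpen U) : IsOpen U := by
  rw [hU]
  exact isOpen_interior

theorem regOpen_Ioo {a b : ℝ} (h : a < b) : RegOpen (Set.Ioo a b) := by
  rw [RegOpen, closure_Ioo h.ne, interior_Icc]

theorem neg_one_div_lt_one_div {n : ℕ} (hn : 1 ≤ n) : -(1 / (n : ℝ)) < 1 / (n : ℝ) :=
  neg_lt_self (one_div_pos.2 (by exact_mod_cast hn))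

theorem closure_Ioo_one_div_subset {m n : ℕ} (hm : 1 ≤ m) (h : m < n) :
    closure (Set.Ioo (-(1 / (n : ℝ))) (1 / (n : ℝ))) ⊆
      Set.Ioo (-(1 / (m : ℝ))) (1 / (m : ℝ)) := by
  have hlt : 1 / (n : ℝ) < 1 / (m : ℝ) :=
    one_div_lt_one_div_of_lt (by exact_mod_cast hm) (by exact_mod_cast h)
  rw [closure_Ioo (neg_one_div_lt_one_div (hm.trans h.le)).ne]
  exact Set.Icc_subset_Ioo (neg_lt_neg hlt) hlt

theorem roAbstractive_AIntervals : ROAbstractive AIntervals := by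
  refine ⟨?_, ⟨_, 1, le_rfl, rfl⟩, ?_, ?_, ?_⟩
  · rintro _ ⟨n, hn, rfl⟩
    exact regOpen_Ioo (neg_one_div_lt_one_div hn)
  · rintro ⟨n, hn, h⟩
    exact (Set.nonempty_Ioo.2 (neg_one_div_lt_one_div hn)).ne_empty h.symm
  · rintro _ ⟨m, hm, rfl⟩ _ ⟨n, hn, rfl⟩
    rcases lt_trichotomy m n with h | rfl | h
    · exact .inr (.inr (closure_Ioo_one_div_subset hm h))
    · exact .inl rfl
    · exact .inr (.inl (closure_Ioo_one_div_subset hn h))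
  · rintro ⟨_, ⟨n, hn, rfl⟩, h⟩
    have hsub := h _ ⟨n + 1, by omega, rfl⟩
    rw [Set.Ioo_subset_Ioo_iff (neg_one_div_lt_one_div hn)] at hsub
    have hlt : 1 / ((n + 1 : ℕ) : ℝ) < 1 / (n : ℝ) :=
      one_div_lt_one_div_of_lt (by exact_mod_cast hn) (by exact_mod_cast n.lt_succ_self)
    exact hlt.not_ge hsub.2

/-- Two members of an abstractive set always meet. -/
theorem ROAbstractive.inter_nonempty {A : Set (Set ℝ)} (hA : ROAbstractive A) {U V : Set ℝ}
    (hU : U ∈ A) (hV : V ∈ A) : (U ∩ V).Nonempty := by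
  obtain ⟨-, -, hempty, hchain, -⟩ := hA
  have hne : ∀ W ∈ A, W.Nonempty := fun W hW =>
    Set.nonempty_iff_ne_empty.2 (ne_of_mem_of_not_mem hW hempty)
  rcases hchain U hU V hV with rfl | h | h
  · simpa using hne U hU
  · rw [Set.inter_eq_left.2 (subset_closure.trans h)]
    exact hne U hU
  · rw [Set.inter_eq_right.2 (subset_closure.trans h)]
    exact hne V hV

/-- Every member of an abstractive set has another member well inside it. -/
theorem ROAbstractive.exists_closure_subset {A : Set (Set ℝ)} (hA : ROAbstractive A) {U : Set ℝ}
    (hU : U ∈ A) : ∃ W ∈ A, closure W ⊆ U := by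
  obtain ⟨-, -, -, hchain, hmin⟩ := hA
  push Not at hmin
  obtain ⟨W, hW, hUW⟩ := hmin U hU
  rcases hchain U hU W hW with rfl | h | h
  · exact absurd subset_rfl hUW
  · exact absurd (subset_closure.trans h) hUW
  · exact ⟨W, hW, h⟩

theorem ROCovers.zero_mem_closure {A : Set (Set ℝ)} (hA : ROAbstractive A)
    (hcov : ROCovers AIntervals A) {W : Set ℝ} (hW : W ∈ A) : (0 : ℝ) ∈ closure W := by
  rw [mem_closure_iff_nhds]
  intro N hN
  obtain ⟨n, hn, hnN⟩ := exists_Ioo_one_div_subset hN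
  obtain ⟨V, hV, hVn⟩ := hcov _ ⟨n, hn, rfl⟩
  exact (hA.inter_nonempty hV hW).mono (Set.inter_subset_inter_left _ (hVn.trans hnN))

theorem stmt_17 :
    ROAbstractive AIntervals ∧
      ∀ A' : Set (Set ℝ), ROAbstractive A' → ROCovers AIntervals A' →
        ROCovers A' AIntervals := by
  refine ⟨roAbstractive_AIntervals, fun A' hA' hcov U hU => ?_⟩
  obtain ⟨W, hW, hWU⟩ := hA'.exists_closure_subset hU
  obtain ⟨n, hn, hnU⟩ := exists_Ioo_one_div_subset
    ((hA'.1 U hU).isOpen.mem_nhds (hWU (hcov.zero_mem_closure hA' hW)))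
  exact ⟨_, ⟨n, hn, rfl⟩, hnU⟩
end

section
/- Let B be a Boolean contact algebra satisfying (G1): for every x ≠ 0 there is a G-representative Q with x ∈ Q, and satisfying the countable chain condition. Let Grz(B) be the set of G-points of B with the topology generated by the sets G(x) = {𝒢 ∈ Grz(B) : x ∈ 𝒢} for x ∈ B. Then Grz(B) satisfies the topological countable chain condition: every family of pairwise disjoint nonempty open subsets of Grz(B) is countable. -/
variable {B : Type*} [BooleanAlgebra B]

/-- The set of Grzegorczyk points of a Boolean contact algebra. -/
def BCA.Grz {B : Type*} [BooleanAlgebra B] (A : BCA B) : Set (Set B) :=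
  {G | A.IsGPoint G}

namespace BCA

theorem le_of_wi {B : Type*} [BooleanAlgebra B] (A : BCA B) {x y : B} (h : A.wi x y) :
    x ≤ y := by
  by_contra hxy
  have hne : x ⊓ yᶜ ≠ ⊥ := fun he => hxy (by rwa [← sdiff_eq, sdiff_eq_bot_iff] at he)
  exact h (A.c2 _ _ (A.c3 _ _ _ inf_le_left (A.c2 _ _ (A.c1 _ _ hne inf_le_right))))

theorem IsGPoint.isFilter {B : Type*} [BooleanAlgebra B] {A : BCA B} {G : Set B}
    (hG : A.IsGPoint G) : IsFilter G := by
  obtain ⟨Q, ⟨⟨q, hq⟩, hbot, hchain, -, -⟩, rfl⟩ := hG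
  refine ⟨⟨q, q, hq, le_rfl⟩, ?_, ?_, ?_⟩
  · rintro ⟨x, hx, hle⟩
    exact hbot (le_bot_iff.mp hle ▸ hx)
  · rintro x ⟨u, hu, hux⟩ y hxy
    exact ⟨u, hu, hux.trans hxy⟩
  · rintro x ⟨u, hu, hux⟩ y ⟨v, hv, hvy⟩
    rcases hchain u hu v hv with rfl | h | h
    · exact ⟨u, hu, le_inf hux hvy⟩
    · exact ⟨u, hu, le_inf hux ((A.le_of_wi h).trans hvy)⟩
    · exact ⟨v, hv, le_inf ((A.le_of_wi h).trans hux) hvy⟩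

/-- The sets `G(x)` form a base, not just a subbase, of the topology on Grzegorczyk points. -/
theorem exists_mem_subset_of_generateOpen {B : Type*} [BooleanAlgebra B] {A : BCA B}
    {U : Set (Grz A)}
    (hU : TopologicalSpace.GenerateOpen
      {s : Set (Grz A) | ∃ x : B, s = {G | x ∈ G.1}} U) :
    ∀ G ∈ U, ∃ x ∈ G.1, {H : Grz A | x ∈ H.1} ⊆ U := by
  induction hU with
  | basic s hs =>
    obtain ⟨x, rfl⟩ := hs
    exact fun G hG => ⟨x, hG, subset_rfl⟩
  | univ =>
    intro G _
    obtain ⟨x, hx⟩ := (IsGPoint.isFilter G.2).1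
    exact ⟨x, hx, Set.subset_univ _⟩
  | inter s t _ _ ihs iht =>
    rintro G ⟨hs, ht⟩
    obtain ⟨x, hx, hxs⟩ := ihs G hs
    obtain ⟨y, hy, hyt⟩ := iht G ht
    refine ⟨x ⊓ y, (IsGPoint.isFilter G.2).2.2.2 x hx y hy, fun H hH => ?_⟩
    have hup := (IsGPoint.isFilter H.2).2.2.1 _ hH
    exact ⟨hxs (hup x inf_le_left), hyt (hup y inf_le_right)⟩
  | sUnion S _ ih =>
    rintro G ⟨s, hs, hGs⟩
    obtain ⟨x, hx, hxs⟩ := ih s hs G hGs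
    exact ⟨x, hx, hxs.trans (Set.subset_sUnion_of_mem hs)⟩

end BCA

theorem stmt_19 {B : Type*} [BooleanAlgebra B] (A : BCA B)
    (hG1 : ∀ x : B, x ≠ ⊥ → ∃ Q : Set B, A.IsGRep Q ∧ x ∈ Q)
    (hccc : BCA.CCC B) :
    ∀ 𝒰 : Set (Set (BCA.Grz A)),
      (∀ U ∈ 𝒰, @IsOpen _ (TopologicalSpace.generateFrom
        {s : Set (BCA.Grz A) | ∃ x : B, s = {G | x ∈ G.1}}) U) →
      (∀ U ∈ 𝒰, U.Nonempty) →
      (𝒰.Pairwise fun U V => U ∩ V = ∅) →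
      𝒰.Countable := by
  intro 𝒰 hopen hne hdisj
  have hbase : ∀ U : Set (BCA.Grz A), ∃ x : B, U ∈ 𝒰 →
      x ≠ ⊥ ∧ {H : BCA.Grz A | x ∈ H.1} ⊆ U := by
    intro U
    by_cases hU : U ∈ 𝒰
    · obtain ⟨G, hG⟩ := hne U hU
      obtain ⟨x, hx, hxU⟩ := BCA.exists_mem_subset_of_generateOpen (hopen U hU) G hG
      refine ⟨x, fun _ => ⟨?_, hxU⟩⟩
      rintro rfl
      exact (BCA.IsGPoint.isFilter G.2).2.1 hx
    · exact ⟨⊥, fun h => absurd h hU⟩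
  choose f hf using hbase
  have hinf : ∀ U ∈ 𝒰, ∀ V ∈ 𝒰, U ≠ V → f U ⊓ f V = ⊥ := by
    intro U hU V hV hUV
    by_contra hb
    obtain ⟨Q, hQ, hmem⟩ := hG1 _ hb
    let G : BCA.Grz A := ⟨{y | ∃ x ∈ Q, x ≤ y}, Q, hQ, rfl⟩
    have hG : G ∈ U ∩ V :=
      ⟨(hf U hU).2 ⟨_, hmem, inf_le_left⟩, (hf V hV).2 ⟨_, hmem, inf_le_right⟩⟩
    rw [hdisj hU hV hUV] at hG
    exact hG
  have hinj : Set.InjOn f 𝒰 := by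
    intro U hU V hV hUV
    by_contra hne'
    have h := hinf U hU V hV hne'
    rw [← hUV, inf_idem] at h
    exact (hf U hU).1 h
  refine Set.countable_of_injective_of_countable_image hinj (hccc _ ?_ ?_)
  · rintro _ ⟨U, hU, rfl⟩
    exact (hf U hU).1
  · rintro _ ⟨U, hU, rfl⟩ _ ⟨V, hV, rfl⟩ hUV
    exact hinf U hU V hV fun h => hUV (congrArg f h)
end
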